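/- Let Ω ⊆ ℝ^N be a Lebesgue-measurable set and p : Ω → ℝ a measurable function with 2 < p^- ≤ p^+ < ∞. Then for all u, v ∈ L^{p(·)}(Ω): ∫_Ω ||u(x)|^{p(x)−2}u(x) − |v(x)|^{p(x)−2}v(x)|^{p(x)/(p(x)−1)} dx ≤ (p^+)^{p^+/(p^- − 1)} · ∫_Ω |u(x)−v(x)|^{p(x)/(p(x)−1)} · max(|u(x)|,|v(x)|)^{p(x)(p(x)−2)/(p(x)−1)} dx. -/

import Mathlib

open MeasureTheory Filter Topology

/-- The modular `ρ_{p(·)}(u) = ∫_Ω |u(x)|^{p(x)} dx` (as an extended nonnegative real);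
`u` belongs to `L^{p(·)}(Ω)` iff this is finite. -/
noncomputable def modular {N : ℕ} (Ω : Set (EuclideanSpace ℝ (Fin N)))
    (p u : EuclideanSpace ℝ (Fin N) → ℝ) : ENNReal :=
  ∫⁻ x in Ω, ENNReal.ofReal (|u x| ^ p x)

/-- The Luxemburg norm `|u|_{p(·)} = inf {α > 0 : ∫_Ω |u(x)/α|^{p(x)} dx ≤ 1}`. -/
noncomputable def luxNorm {N : ℕ} (Ω : Set (EuclideanSpace ℝ (Fin N)))
    (p u : EuclideanSpace ℝ (Fin N) → ℝ) : ℝ :=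
  sInf {α : ℝ | 0 < α ∧ (∫⁻ x in Ω, ENNReal.ofReal (|u x / α| ^ p x)) ≤ 1}

/-- The signed power `t ↦ |t|^{q-2} t` satisfies the Lagrange estimate when the point of larger
absolute value is positive. -/
theorem abs_signedPow_sub_le_of_abs_le {q a b : ℝ} (hq : 2 < q) (ha : 0 < a) (hb : |b| ≤ a) :
    |(|a| ^ (q - 2) * a - |b| ^ (q - 2) * b)| ≤ (q - 1) * (|a - b| * a ^ (q - 2)) := by
  have hba := abs_le.1 hb
  have hA : 0 < a ^ (q - 2) := Real.rpow_pos_of_pos ha _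
  have hB : 0 ≤ |b| ^ (q - 2) := by positivity
  have hBA : |b| ^ (q - 2) ≤ a ^ (q - 2) :=
    Real.rpow_le_rpow (abs_nonneg b) hb (by linarith)
  rw [abs_of_pos ha, abs_of_nonneg (sub_nonneg.2 hba.2)]
  rcases le_total 0 b with h0 | h0
  · rw [abs_of_nonneg h0] at hB hBA ⊢
    rw [abs_of_nonneg (sub_nonneg.2 (mul_le_mul hBA hba.2 h0 hA.le))]
    obtain ⟨t, ht, rfl⟩ : ∃ t, 0 ≤ t ∧ b = t * a :=
      ⟨b / a, div_nonneg h0 ha.le, (div_mul_cancel₀ b ha.ne').symm⟩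
    have hbern := one_add_mul_self_le_rpow_one_add (s := t - 1) (by linarith)
      (p := q - 1) (by linarith)
    have ht' : t ^ (q - 1) = t ^ (q - 2) * t := by
      rw [← Real.rpow_add_one' ht (by linarith)]
      ring_nf
    rw [add_sub_cancel, ht'] at hbern
    rw [Real.mul_rpow ht ha.le]
    nlinarith [mul_le_mul_of_nonneg_left hbern (mul_pos hA ha).le]
  · rw [abs_of_nonneg (by nlinarith [mul_pos hA ha])]
    have h1 : a ^ (q - 2) * a - |b| ^ (q - 2) * b ≤ (a - b) * a ^ (q - 2) := by nlinarith
    have h2 : 0 ≤ (a - b) * a ^ (q - 2) := mul_nonneg (by linarith) hA.le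
    nlinarith

/-- Lagrange estimate for the signed power `t ↦ |t|^{q-2} t`. -/
theorem abs_signedPow_sub_le {q : ℝ} (hq : 2 < q) (a b : ℝ) :
    |(|a| ^ (q - 2) * a - |b| ^ (q - 2) * b)| ≤
      (q - 1) * (|a - b| * max |a| |b| ^ (q - 2)) := by
  wlog h : |b| ≤ |a| generalizing a b
  · rw [abs_sub_comm, abs_sub_comm a, max_comm]
    exact this b a (le_of_not_ge h)
  rw [max_eq_left h]
  rcases lt_trichotomy a 0 with ha | rfl | ha
  · have := abs_signedPow_sub_le_of_abs_le hq (a := -a) (b := -b) (by linarith)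
      (by rwa [abs_neg, ← abs_of_neg ha])
    rw [abs_neg, abs_neg, mul_neg, mul_neg, neg_sub_neg, neg_sub_neg, abs_sub_comm,
      abs_sub_comm b] at this
    rwa [abs_of_neg ha] at this ⊢
  · obtain rfl : b = 0 := by simpa using h
    simp
  · rw [abs_of_pos ha] at h
    have := abs_signedPow_sub_le_of_abs_le hq ha h
    rwa [abs_of_pos ha] at this ⊢

/-- The Lagrange estimate raised to the conjugate exponent `q / (q - 1)`, with a constant uniform
for `q` between `m` and `M`. -/
theorem abs_signedPow_sub_rpow_le {m M q : ℝ} (hm : 2 < m) (hmq : m ≤ q) (hqM : q ≤ M)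
    (a b : ℝ) :
    |(|a| ^ (q - 2) * a - |b| ^ (q - 2) * b)| ^ (q / (q - 1)) ≤
      M ^ (M / (m - 1)) *
        (|a - b| ^ (q / (q - 1)) * max |a| |b| ^ (q * (q - 2) / (q - 1))) := by
  have hq1 : 0 < q - 1 := by linarith
  have he : 0 ≤ q / (q - 1) := div_nonneg (by linarith) hq1.le
  have hmax : 0 ≤ max |a| |b| := le_max_of_le_left (abs_nonneg a)
  have hconst : (q - 1) ^ (q / (q - 1)) ≤ M ^ (M / (m - 1)) :=
    calc (q - 1) ^ (q / (q - 1)) ≤ M ^ (q / (q - 1)) :=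
          Real.rpow_le_rpow hq1.le (by linarith) he
      _ ≤ M ^ (M / (m - 1)) :=
          Real.rpow_le_rpow_of_exponent_le (by linarith)
            (div_le_div₀ (by linarith) hqM (by linarith) (by linarith))
  calc |(|a| ^ (q - 2) * a - |b| ^ (q - 2) * b)| ^ (q / (q - 1))
      ≤ ((q - 1) * (|a - b| * max |a| |b| ^ (q - 2))) ^ (q / (q - 1)) :=
        Real.rpow_le_rpow (abs_nonneg _) (abs_signedPow_sub_le (by linarith) a b) he
    _ = (q - 1) ^ (q / (q - 1)) *
        (|a - b| ^ (q / (q - 1)) * max |a| |b| ^ (q * (q - 2) / (q - 1))) := by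
        rw [Real.mul_rpow hq1.le (by positivity), Real.mul_rpow (abs_nonneg _) (by positivity),
          ← Real.rpow_mul hmax]
        congr 3
        ring
    _ ≤ _ := mul_le_mul_of_nonneg_right hconst (by positivity)

/-- (Lagrange-type modular estimate.) For `2 < p⁻ ≤ p⁺ < ∞` and
`u, v ∈ L^{p(·)}(Ω)`,
`∫_Ω ||u|^{p(x)−2}u − |v|^{p(x)−2}v|^{p(x)/(p(x)−1)} dx
  ≤ (p⁺)^{p⁺/(p⁻−1)} ∫_Ω |u−v|^{p(x)/(p(x)−1)} max(|u|,|v|)^{p(x)(p(x)−2)/(p(x)−1)} dx`. -/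
theorem modular_signedPow_estimate {N : ℕ} (Ω : Set (EuclideanSpace ℝ (Fin N)))
    (hΩ : MeasurableSet Ω) (p u v : EuclideanSpace ℝ (Fin N) → ℝ)
    (hp : Measurable p) (hu : Measurable u) (hv : Measurable v)
    (hpm : 2 < essInf p (volume.restrict Ω))
    (hpM : ∃ C : ℝ, ∀ᵐ x ∂volume.restrict Ω, p x ≤ C)
    (huLp : modular Ω p u < ⊤) (hvLp : modular Ω p v < ⊤) :
    (∫⁻ x in Ω, ENNReal.ofReal
        (|(|u x| ^ (p x - 2) * u x - |v x| ^ (p x - 2) * v x)| ^ (p x / (p x - 1)))) ≤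
      ENNReal.ofReal ((essSup p (volume.restrict Ω)) ^
          (essSup p (volume.restrict Ω) / (essInf p (volume.restrict Ω) - 1))) *
        ∫⁻ x in Ω, ENNReal.ofReal
          (|u x - v x| ^ (p x / (p x - 1)) *
            max |u x| |v x| ^ (p x * (p x - 2) / (p x - 1))) := by
  have hbelow : IsBoundedUnder (· ≥ ·) (ae (volume.restrict Ω)) p := by
    by_contra hne
    have hempty : {c : ℝ | ∀ᵐ x ∂volume.restrict Ω, c ≤ p x} = ∅ :=
      Set.eq_empty_of_forall_notMem fun c hc => hne ⟨c, eventually_map.2 hc⟩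
    rw [essInf, liminf_eq, hempty, Real.sSup_empty] at hpm
    linarith
  have habove : IsBoundedUnder (· ≤ ·) (ae (volume.restrict Ω)) p :=
    hpM.imp fun _ h => eventually_map.2 h
  rw [← lintegral_const_mul' _ _ ENNReal.ofReal_ne_top]
  refine lintegral_mono_ae ?_
  filter_upwards [ae_essInf_le hbelow, ae_le_essSup habove] with x hmx hMx
  have hM : 0 ≤ essSup p (volume.restrict Ω) := by linarith
  rw [← ENNReal.ofReal_mul (Real.rpow_nonneg hM _)]
  exact ENNReal.ofReal_le_ofReal (abs_signedPow_sub_rpow_le hpm hmx hMx (u x) (v x))
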